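/- Let G be a solvable group with the property K̄∞, and let D be a periodic divisible abelian normal subgroup of G of infinite total rank, in the sense that for every natural number n there exists a finitely generated subgroup of D that cannot be generated by n elements. Then the commutator subgroup ⁅G,G⁆ of G is finite. -/

import Mathlib

/-- A group `G` has property K̄∞ if for every subgroup `X` of `G` the set of
subgroups of the form `⁅X, H⁆`, with `H` ranging over infinite subgroups of `G`,
is finite. -/
def PropKInf (G : Type*) [Group G] : Prop :=
  ∀ X : Subgroup G, {S : Subgroup G | ∃ H : Subgroup G, Infinite H ∧ S = ⁅X, H⁆}.Finite

theorem k18_jacobson_int : IsJacobsonRing ℤ := by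
  rw [isJacobsonRing_iff_prime_eq]
  intro P hP
  by_cases h : P = ⊥
  · subst h
    rw [eq_bot_iff]
    intro x hx
    by_contra hx0
    have hx0 : x ≠ 0 := hx0
    obtain ⟨p, hp, hpp⟩ := Nat.exists_infinite_primes (x.natAbs + 1)
    have hp' : Prime (p : ℤ) := Nat.prime_iff_prime_int.mp hpp
    rw [Ideal.jacobson, Submodule.mem_sInf] at hx
    have := hx (Ideal.span {(p : ℤ)}) ⟨bot_le, by
      have : (Ideal.span {(p : ℤ)}).IsPrime := (Ideal.span_singleton_prime hp'.ne_zero).2 hp'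
      apply IsPrime.to_maximal_ideal
      simpa using hp'.ne_zero⟩
    rw [Ideal.mem_span_singleton] at this
    have h2 := Int.natAbs_dvd_natAbs.2 this
    simp only [Int.natAbs_natCast] at h2
    have := Nat.le_of_dvd (Int.natAbs_pos.2 hx0) h2
    omega
  · have := IsPrime.to_maximal_ideal h
    exact Ideal.jacobson_eq_self_of_isMaximal

theorem k18_finite_field (K : Type*) [Field K] [Algebra.FiniteType ℤ K] : Finite K := by
  have := k18_jacobson_int
  have hf : Module.Finite ℤ K := finite_of_finite_type_of_isJacobsonRing ℤ K
  obtain ⟨p, hp⟩ := CharP.exists K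
  rcases CharP.char_is_prime_or_zero K p with hpp | h0
  · have : Fact p.Prime := ⟨hpp⟩
    let := ZMod.algebra K p
    have : Module.Finite (ZMod p) K := Module.Finite.of_restrictScalars_finite ℤ (ZMod p) K
    exact Module.finite_of_finite (ZMod p)
  · subst h0
    have : CharZero K := CharP.charP_to_charZero K
    have := isField_of_isIntegral_of_isField (R := ℤ) (S := K)
      (by simpa using Int.cast_injective) (Field.toIsField K)
    exact absurd this Int.not_isField

theorem k18_finite_field' {R K : Type*} [CommRing R] [Algebra.FiniteType ℤ R] [Field K]
    (f : R →+* K) (hf : Function.Surjective f) : Finite K := by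
  have : Algebra.FiniteType ℤ K := Algebra.FiniteType.of_surjective f.toIntAlgHom hf
  exact k18_finite_field K

theorem k18_finite_module {R M : Type*} [CommRing R] [Algebra.FiniteType ℤ R] [AddCommGroup M]
    [Module R M] [Finite (Submodule R M)] : Finite M := by
  suffices h : ∀ N : Submodule R M, Finite N by
    have := h ⊤
    exact Finite.of_equiv _ (Submodule.topEquiv (R := R) (M := M)).toEquiv
  intro N
  induction N using WellFoundedLT.induction with
  | ind N ih =>
    by_cases hN : N = ⊥
    · subst hN; infer_instance
    · have : Finite (Submodule R N) := Finite.of_equiv _ (Submodule.mapIic N).toEquiv.symm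
      have : Nontrivial N := by rwa [Submodule.nontrivial_iff_ne_bot]
      obtain ⟨L, hL, -⟩ := (eq_top_or_exists_le_coatom (⊥ : Submodule R N)).resolve_left bot_ne_top
      have hfin : Finite L := by
        have hlt : L.map N.subtype < N := by
          have := (Submodule.map_strictMono_of_injective N.injective_subtype) hL.lt_top
          simpa using this
        have := ih _ hlt
        exact Finite.of_equiv _ (Submodule.equivMapOfInjective N.subtype N.injective_subtype L).toEquiv.symm
      have : IsSimpleModule R (N ⧸ L) := isSimpleModule_iff_isCoatom.2 hL
      obtain ⟨m, hm, ⟨e⟩⟩ := isSimpleModule_iff_quot_maximal.1 this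
      let := Ideal.Quotient.field m
      have : Finite (R ⧸ m) := k18_finite_field' (Ideal.Quotient.mk m) Ideal.Quotient.mk_surjective
      have : Finite (N ⧸ L) := Finite.of_equiv _ e.toEquiv.symm
      have : Finite (N ⧸ L.toAddSubgroup) := this
      have : Finite L.toAddSubgroup := hfin
      exact Finite.of_equiv _ (AddSubgroup.addGroupEquivQuotientProdAddSubgroup
        (s := L.toAddSubgroup)).symm

open scoped commutatorElement

theorem k18_fin_le {G : Type*} [Group G] {H K : Subgroup G} (hK : Finite K) (hle : H ≤ K) :
    Finite H := Finite.of_injective _ (Subgroup.inclusion_injective hle)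

theorem k18_ft {R : Type*} [CommRing R] (a : Algebra ℤ R) (h : @Algebra.FiniteType ℤ R _ _ a) :
    @Algebra.FiniteType ℤ R _ _ (Ring.toIntAlgebra R) := by
  rwa [Subsingleton.elim (Ring.toIntAlgebra R) a]

theorem k18_abs {V : Type*} [CommGroup V] (t : MulAut V)
    (hfin : {L : Subgroup V | (∀ x ∈ L, t x ∈ L) ∧ (∀ x ∈ L, t⁻¹ x ∈ L) ∧
      ∀ x ∈ L, ∃ v, x = t v * v⁻¹}.Finite) :
    (Set.range fun v => t v * v⁻¹).Finite := by
  let θ : MulAut V →* Module.End ℤ (Additive V) :=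
    { toFun := fun s => (MonoidHom.toAdditive s.toMonoidHom).toIntLinearMap
      map_one' := rfl
      map_mul' := fun _ _ => rfl }
  let ρ : Representation ℤ (Multiplicative ℤ) (Additive V) := θ.comp (zpowersHom _ t)
  let R := MonoidAlgebra ℤ (Multiplicative ℤ)
  let u : Multiplicative ℤ := Multiplicative.ofAdd 1
  have hu : ∀ x : ρ.asModule, (MonoidAlgebra.single u (1 : ℤ) : R) • x
      = (Additive.ofMul (t (Additive.toMul (α := V) x)) : Additive V) := by
    intro x
    rw [Representation.single_smul, one_smul]
    change (θ.comp (zpowersHom _ t)) u x = _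
    simp [u, θ]
    rfl
  have hu' : ∀ x : ρ.asModule, (MonoidAlgebra.single u⁻¹ (1 : ℤ) : R) • x
      = (Additive.ofMul (t⁻¹ (Additive.toMul (α := V) x)) : Additive V) := by
    intro x
    rw [Representation.single_smul, one_smul]
    change (θ.comp (zpowersHom _ t)) u⁻¹ x = _
    simp [u, θ]
    rfl
  let r : R := MonoidAlgebra.single u (1 : ℤ) - 1
  let Φ : ρ.asModule →ₗ[R] ρ.asModule := r • LinearMap.id
  have hΦ : ∀ x : ρ.asModule, Φ x =
      (Additive.ofMul (t (Additive.toMul (α := V) x) * (Additive.toMul (α := V) x)⁻¹) : Additive V) := by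
    intro x
    change r • x = _
    rw [sub_smul, hu, one_smul, ← div_eq_mul_inv]
    rfl
  let f : Submodule R ρ.asModule → Subgroup V := fun L => AddSubgroup.toSubgroup' L.toAddSubgroup
  have hf : ∀ L (x : V), x ∈ f L ↔ (Additive.ofMul x : ρ.asModule) ∈ L := fun _ _ => Iff.rfl
  have hfinj : Function.Injective f := by
    intro L L' h
    ext x
    exact (SetLike.ext_iff.1 h (Additive.toMul (α := V) x))
  have hIic : (Set.Iic (LinearMap.range Φ)).Finite := by
    refine Set.Finite.of_injOn (f := f) ?_ hfinj.injOn hfin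
    intro L hL
    refine ⟨?_, ?_, ?_⟩
    · intro x hx
      rw [hf] at hx ⊢
      have := L.smul_mem (MonoidAlgebra.single u (1 : ℤ) : R) hx
      have e := hu (Additive.ofMul x : Additive V)
      exact e ▸ this
    · intro x hx
      rw [hf] at hx ⊢
      have := L.smul_mem (MonoidAlgebra.single u⁻¹ (1 : ℤ) : R) hx
      have e := hu' (Additive.ofMul x : Additive V)
      exact e ▸ this
    · intro x hx
      rw [hf] at hx
      obtain ⟨v, hv⟩ := hL hx
      rw [hΦ] at hv
      exact ⟨Additive.toMul (α := V) v, hv.symm⟩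
  have : Finite (Set.Iic (LinearMap.range Φ)) := hIic
  have : Finite (Submodule R (LinearMap.range Φ)) :=
    Finite.of_equiv _ (Submodule.mapIic (LinearMap.range Φ)).toEquiv.symm
  have :=
    (inferInstance : Algebra.FiniteType ℤ (MonoidAlgebra ℤ (Multiplicative ℤ)))
  have hM : Finite (LinearMap.range Φ) := @k18_finite_module R _ _ (k18_ft _ this) _ _ _
  have hM' : ((LinearMap.range Φ : Submodule R ρ.asModule) : Set ρ.asModule).Finite := hM
  refine Set.Finite.subset (s := Set.image (fun x : ρ.asModule => Additive.toMul (α := V) x) (LinearMap.range Φ))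
    (hM'.image _) ?_
  rintro _ ⟨v, rfl⟩
  exact ⟨Φ (Additive.ofMul v : Additive V), ⟨_, rfl⟩, hΦ (Additive.ofMul v : Additive V)⟩

/-- every set of commutator subgroups with one fixed entry is finite -/
def K18 (G : Type*) [Group G] : Prop :=
  ∀ X : Subgroup G, {S : Subgroup G | ∃ H : Subgroup G, S = ⁅X, H⁆}.Finite

theorem K18.subgroup {G : Type*} [Group G] (h : K18 G) (P : Subgroup G) : K18 P := by
  intro X
  refine Set.Finite.of_injOn (f := Subgroup.map P.subtype) ?_
    (Subgroup.map_injective P.subtype_injective).injOn (h (X.map P.subtype))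
  rintro _ ⟨H, rfl⟩
  exact ⟨H.map P.subtype, Subgroup.map_commutator _ _ _⟩

theorem K18.quotient {G : Type*} [Group G] (h : K18 G) (N : Subgroup G) [N.Normal] :
    K18 (G ⧸ N) := by
  intro X
  refine ((h (X.comap (QuotientGroup.mk' N))).image (Subgroup.map (QuotientGroup.mk' N))).subset ?_
  rintro _ ⟨H, rfl⟩
  refine ⟨_, ⟨H.comap (QuotientGroup.mk' N), rfl⟩, ?_⟩
  rw [Subgroup.map_commutator, Subgroup.map_comap_eq_self_of_surjective (QuotientGroup.mk'_surjective N),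
    Subgroup.map_comap_eq_self_of_surjective (QuotientGroup.mk'_surjective N)]

theorem k18_zpowers_commutator_le {G : Type*} [Group G] (g : G) (B L : Subgroup G)
    (h1 : ∀ x ∈ L, g * x * g⁻¹ ∈ L) (h2 : ∀ x ∈ L, g⁻¹ * x * g ∈ L)
    (h3 : ∀ b ∈ B, ⁅g, b⁆ ∈ L) : ⁅Subgroup.zpowers g, B⁆ ≤ L := by
  rw [Subgroup.commutator_le]
  intro y hy b hb
  obtain ⟨n, rfl⟩ := Subgroup.mem_zpowers_iff.1 hy
  induction n with
  | zero => simp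
  | succ n ih =>
    have e : ⁅g ^ ((n : ℤ) + 1), b⁆ = (g * ⁅g ^ (n : ℤ), b⁆ * g⁻¹) * ⁅g, b⁆ := by
      rw [add_comm, zpow_add, zpow_one]; simp only [commutatorElement_def]; group
    rw [e]
    exact L.mul_mem (h1 _ (ih ⟨n, rfl⟩)) (h3 b hb)
  | pred n ih =>
    have e : ⁅g ^ (-(n : ℤ) - 1), b⁆ = (g⁻¹ * ⁅g ^ (-(n : ℤ)), b⁆ * g) * (g⁻¹ * ⁅g, b⁆⁻¹ * g) := by
      rw [sub_eq_add_neg, add_comm, zpow_add, zpow_neg_one]; simp only [commutatorElement_def]; group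
    rw [e]
    exact L.mul_mem (h2 _ (ih ⟨_, rfl⟩)) (h2 _ (L.inv_mem (h3 b hb)))

theorem k18_core {G : Type*} [Group G] (h : K18 G) (A : Subgroup G) (hn : A.Normal)
    (hc : ∀ x ∈ A, ∀ y ∈ A, x * y = y * x) (g : G) : Finite (⁅Subgroup.zpowers g, A⁆ : Subgroup G) := by
  let _ : CommGroup A := { (inferInstance : Group A) with
    mul_comm := fun x y => Subtype.ext (hc x x.2 y y.2) }
  let t : MulAut A := MulAut.conjNormal g
  have ht : ∀ x : A, ((t x : A) : G) = g * x * g⁻¹ := fun x => MulAut.conjNormal_apply g x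
  have ht' : ∀ x : A, ((t⁻¹ x : A) : G) = g⁻¹ * x * g := fun x => MulAut.conjNormal_inv_apply g x
  have key : (Set.range fun v : A => t v * v⁻¹).Finite := by
    apply k18_abs
    refine Set.Finite.of_injOn (f := Subgroup.map A.subtype) ?_
      (Subgroup.map_injective A.subtype_injective).injOn (h (Subgroup.zpowers g))
    rintro L ⟨h1, h2, h3⟩
    let B : Subgroup A := 
      { carrier := {v | t v * v⁻¹ ∈ L}
        one_mem' := by simp
        mul_mem' := by
          intro a b ha hb
          have : t (a * b) * (a * b)⁻¹ = (t a * a⁻¹) * (t b * b⁻¹) := by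
            rw [map_mul, mul_inv, mul_mul_mul_comm]
          simpa only [Set.mem_ofPred_eq, this] using L.mul_mem ha hb
        inv_mem' := by
          intro a ha
          have : t a⁻¹ * a⁻¹⁻¹ = (t a * a⁻¹)⁻¹ := by
            rw [map_inv, mul_inv]
          simpa only [Set.mem_ofPred_eq, this] using L.inv_mem ha }
    refine ⟨B.map A.subtype, le_antisymm ?_ ?_⟩
    · rintro _ ⟨x, hx, rfl⟩
      obtain ⟨v, rfl⟩ := h3 x hx
      have : A.subtype (t v * v⁻¹) = ⁅g, (v : G)⁆ := by
        simp [ht, commutatorElement_def]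
      rw [this]
      exact Subgroup.commutator_mem_commutator (Subgroup.mem_zpowers g) ⟨v, hx, rfl⟩
    · apply k18_zpowers_commutator_le
      · rintro _ ⟨x, hx, rfl⟩
        exact ⟨t x, h1 x hx, ht x⟩
      · rintro _ ⟨x, hx, rfl⟩
        exact ⟨t⁻¹ x, h2 x hx, ht' x⟩
      · rintro _ ⟨v, hv, rfl⟩
        exact ⟨t v * v⁻¹, hv, by simp [ht, commutatorElement_def]⟩
  let φ : A →* A :=
    { toFun := fun v => t v * v⁻¹
      map_one' := by simp
      map_mul' := by
        intro a b
        rw [map_mul, mul_inv, mul_mul_mul_comm] }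
  have hφ : ((φ.range.map A.subtype : Subgroup G) : Set G).Finite := by
    rw [Subgroup.coe_map]
    exact Set.Finite.image _ key
  refine hφ.subset (s := (φ.range.map A.subtype : Subgroup G)) ?_
  apply k18_zpowers_commutator_le
  · rintro _ ⟨_, ⟨x, rfl⟩, rfl⟩
    exact ⟨t (φ x), ⟨t x, by simp [φ]⟩, ht _⟩
  · rintro _ ⟨_, ⟨x, rfl⟩, rfl⟩
    exact ⟨t⁻¹ (φ x), ⟨t⁻¹ x, by simp [φ]⟩, ht' _⟩
  · intro b hb
    exact ⟨_, ⟨⟨b, hb⟩, rfl⟩, by simp [φ, ht, commutatorElement_def]⟩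

theorem k18_sSup {G : Type*} [Group G] (A : Subgroup G)
    (hc : ∀ x ∈ A, ∀ y ∈ A, x * y = y * x) (S : Set (Subgroup G)) (hS : S.Finite)
    (hf : ∀ P ∈ S, Finite P) (hA : ∀ P ∈ S, P ≤ A) : Finite (sSup S : Subgroup G) := by
  induction S, hS using Set.Finite.induction_on with
  | empty => rw [sSup_empty]; infer_instance
  | @insert P T _ _ ih =>
    rw [sSup_insert]
    have h1 := ih (fun Q hQ => hf Q (Or.inr hQ)) (fun Q hQ => hA Q (Or.inr hQ))
    have h2 : sSup T ≤ A := sSup_le fun Q hQ => hA Q (Or.inr hQ)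
    have h3 := hA P (Or.inl rfl)
    have h4 := hf P (Or.inl rfl)
    have h5 : P ≤ Subgroup.normalizer ((sSup T : Subgroup G) : Set G) := by
      intro x hx
      rw [Subgroup.mem_normalizer_iff'']
      intro y
      constructor
      · intro hy
        rwa [hc _ (A.inv_mem (h3 hx)) y (h2 hy), inv_mul_cancel_right]
      · intro hy
        have := hc _ (h3 hx) _ (h2 hy)
        have e : y = x⁻¹ * y * x := by
          have : x * (x⁻¹ * y * x) = (x⁻¹ * y * x) * x := this
          have h6 : y * x = x⁻¹ * y * x * x := by rw [← this]; group
          exact mul_right_cancel h6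
        rw [e]; exact hy
    have h6 := Subgroup.coe_mul_of_left_le_normalizer_right _ _ h5
    have h7 : ((P ⊔ sSup T : Subgroup G) : Set G).Finite := by
      rw [h6]
      exact Set.Finite.mul h4 h1
    exact h7

theorem k18_abelian {G : Type*} [Group G] (h : K18 G) (A : Subgroup G) (hn : A.Normal)
    (hc : ∀ x ∈ A, ∀ y ∈ A, x * y = y * x) : Finite (⁅A, (⊤ : Subgroup G)⁆ : Subgroup G) := by
  have hfin := k18_sSup A hc {S | ∃ g : G, S = ⁅A, Subgroup.zpowers g⁆}
    ((h A).subset (by rintro _ ⟨g, rfl⟩; exact ⟨_, rfl⟩))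
    (by rintro _ ⟨g, rfl⟩; rw [Subgroup.commutator_comm]; exact k18_core h A hn hc g)
    (by rintro _ ⟨g, rfl⟩; exact Subgroup.commutator_le_left _ _)
  refine k18_fin_le hfin ?_
  rw [Subgroup.commutator_le]
  intro a ha g _
  have hle : ⁅A, Subgroup.zpowers g⁆ ≤ sSup {S | ∃ g : G, S = ⁅A, Subgroup.zpowers g⁆} :=
    le_sSup ⟨g, rfl⟩
  exact hle (Subgroup.commutator_mem_commutator ha (Subgroup.mem_zpowers g))

theorem k18_class_two {G : Type*} [Group G] (h : K18 G) (hz : commutator G ≤ Subgroup.center G) :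
    Finite (commutator G) := by
  have hx : ∀ x : G, Finite (⁅(⊤ : Subgroup G), Subgroup.zpowers x⁆ : Subgroup G) := by
    intro x
    let A := Subgroup.zpowers x ⊔ Subgroup.center G
    have hn : A.Normal := by
      refine ⟨fun n hn g => ?_⟩
      have : g * n * g⁻¹ = ⁅g, n⁆ * n := by simp [commutatorElement_def]
      rw [this]
      refine A.mul_mem ?_ hn
      exact (le_sup_right : _ ≤ A) (hz (Subgroup.commutator_mem_commutator (Subgroup.mem_top _) (Subgroup.mem_top _)))
    have hc : ∀ a ∈ A, ∀ b ∈ A, a * b = b * a := by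
      intro a ha b hb
      obtain ⟨y, hy, z, hz, rfl⟩ := Subgroup.mem_sup_of_normal_right.1 ha
      obtain ⟨y', hy', z', hz', rfl⟩ := Subgroup.mem_sup_of_normal_right.1 hb
      obtain ⟨n, rfl⟩ := Subgroup.mem_zpowers_iff.1 hy
      obtain ⟨m, rfl⟩ := Subgroup.mem_zpowers_iff.1 hy'
      rw [Subgroup.mem_center_iff] at hz hz'
      have c1 : Commute (x ^ n) (x ^ m * z') :=
        ((Commute.refl x).zpow_zpow n m).mul_right (hz' (x ^ n))
      have c2 : Commute z (x ^ m * z') := (hz (x ^ m * z')).symm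
      exact c1.mul_left c2
    have := k18_abelian h A hn hc
    rw [Subgroup.commutator_comm]
    exact k18_fin_le this (Subgroup.commutator_mono le_sup_left le_rfl)
  have hfin := k18_sSup (Subgroup.center G) (fun x hx y _ => (Subgroup.mem_center_iff.1 hx y).symm)
    {S | ∃ x : G, S = ⁅(⊤ : Subgroup G), Subgroup.zpowers x⁆}
    ((h ⊤).subset (by rintro _ ⟨g, rfl⟩; exact ⟨_, rfl⟩))
    (by rintro _ ⟨x, rfl⟩; exact hx x)
    (by rintro _ ⟨g, rfl⟩; exact (Subgroup.commutator_mono le_rfl le_top).trans hz)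
  refine k18_fin_le hfin ?_
  change ⁅(⊤ : Subgroup G), (⊤ : Subgroup G)⁆ ≤ _
  rw [Subgroup.commutator_le]
  intro a ha g _
  have hle : ⁅(⊤ : Subgroup G), Subgroup.zpowers g⁆ ≤
      sSup {S | ∃ x : G, S = ⁅(⊤ : Subgroup G), Subgroup.zpowers x⁆} := le_sSup ⟨g, rfl⟩
  exact hle (Subgroup.commutator_mem_commutator ha (Subgroup.mem_zpowers g))

theorem k18_map_commutator {G : Type*} [Group G] (N : Subgroup G) [N.Normal] :
    (commutator G).map (QuotientGroup.mk' N) = commutator (G ⧸ N) := by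
  rw [commutator_def, commutator_def, Subgroup.map_commutator,
    Subgroup.map_top_of_surjective _ (QuotientGroup.mk'_surjective N)]

theorem k18_ext {G : Type*} [Group G] (N : Subgroup G) [N.Normal] (hN : Finite N)
    (h : Finite (commutator (G ⧸ N))) : Finite (commutator G) := by
  rw [← k18_map_commutator N] at h
  have h1 : ((Subgroup.map (QuotientGroup.mk' N) (commutator G) : Subgroup (G ⧸ N)) : Set (G ⧸ N)).Finite := h
  have h2 : (((Subgroup.map (QuotientGroup.mk' N) (commutator G)).comap (QuotientGroup.mk' N) :
      Subgroup G) : Set G).Finite := by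
    rw [Subgroup.coe_comap]
    refine Set.Finite.preimage' h1 ?_
    intro b _
    obtain ⟨g, rfl⟩ := QuotientGroup.mk'_surjective N b
    have hN' : (N : Set G).Finite := hN
    refine (hN'.image (fun n => g * n)).subset ?_
    intro y hy
    have hy : (QuotientGroup.mk y : G ⧸ N) = QuotientGroup.mk g := hy
    exact ⟨g⁻¹ * y, QuotientGroup.eq.1 hy.symm, by simp⟩
  exact h2.subset (Subgroup.le_comap_map _ _)

theorem k18_derived {G : Type*} [Group G] (n : ℕ) :
    (derivedSeries (commutator G) n).map (commutator G).subtype = derivedSeries G (n + 1) := by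
  induction n with
  | zero => rw [derivedSeries_zero, zero_add, derivedSeries_one, ← MonoidHom.range_eq_map, Subgroup.range_subtype]
  | succ n ih => rw [derivedSeries_succ, Subgroup.map_commutator, ih, ← derivedSeries_succ]

theorem k18_metabelian {G : Type*} [Group G] (hK : K18 G) (hab : derivedSeries G 2 = ⊥) :
    Finite (commutator G) := by
  have hc : ∀ x ∈ commutator G, ∀ y ∈ commutator G, x * y = y * x := by
    intro x hx y hy
    rw [← commutatorElement_eq_one_iff_mul_comm, ← Subgroup.mem_bot, ← hab, derivedSeries_succ,
      derivedSeries_one]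
    exact Subgroup.commutator_mem_commutator hx hy
  have h1 := k18_abelian hK (commutator G) inferInstance hc
  apply k18_ext _ h1
  apply k18_class_two (hK.quotient _)
  rw [← k18_map_commutator, Subgroup.map_le_iff_le_comap]
  intro x hx
  rw [Subgroup.mem_comap, Subgroup.mem_center_iff]
  intro y
  obtain ⟨y, rfl⟩ := QuotientGroup.mk'_surjective _ y
  rw [eq_comm, ← commutatorElement_eq_one_iff_mul_comm, ← map_commutatorElement,
    ← MonoidHom.mem_ker, QuotientGroup.ker_mk']
  exact Subgroup.commutator_mem_commutator hx (Subgroup.mem_top _)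

theorem k18_solvable (n : ℕ) : ∀ (G : Type*) [Group G], K18 G → derivedSeries G n = ⊥ →
    Finite (commutator G) := by
  induction n with
  | zero =>
    intro G _ _ hG
    have : commutator G = ⊥ := by
      rw [eq_bot_iff, ← hG, derivedSeries_zero]; exact le_top
    rw [this]; infer_instance
  | succ n ih =>
    intro G _ hK hG
    have h1 : Finite (commutator (commutator G)) := by
      apply ih _ (hK.subgroup _)
      apply Subgroup.map_injective (commutator G).subtype_injective
      rw [k18_derived, hG, Subgroup.map_bot]
    have hN : Finite (derivedSeries G 2) := by
      rw [← k18_derived 1, derivedSeries_one]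
      exact Finite.of_equiv _ (Subgroup.equivMapOfInjective _ _ (commutator G).subtype_injective).toEquiv
    apply k18_ext (derivedSeries G 2) hN
    have hK' := hK.quotient (derivedSeries G 2)
    have hab : derivedSeries (G ⧸ derivedSeries G 2) 2 = ⊥ := by
      rw [← map_derivedSeries_eq (f := QuotientGroup.mk' (derivedSeries G 2))
        (QuotientGroup.mk'_surjective _), Subgroup.map_eq_bot_iff, QuotientGroup.ker_mk']
    exact k18_metabelian hK' hab

def k18T {G : Type*} [Group G] (D : Subgroup G) (hc : ∀ x ∈ D, ∀ y ∈ D, x * y = y * x) (n : ℕ) :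
    Subgroup G where
  carrier := {d | d ∈ D ∧ d ^ n = 1}
  one_mem' := ⟨D.one_mem, one_pow n⟩
  mul_mem' := by
    rintro a b ⟨ha, ha'⟩ ⟨hb, hb'⟩
    exact ⟨D.mul_mem ha hb, by
      rw [Commute.mul_pow (show Commute a b from hc a ha b hb), ha', hb', one_mul]⟩
  inv_mem' := by
    rintro a ⟨ha, ha'⟩
    exact ⟨D.inv_mem ha, by rw [inv_pow, ha', inv_one]⟩

def k18H {G : Type*} [Group G] (D : Subgroup G) (hc : ∀ x ∈ D, ∀ y ∈ D, x * y = y * x) (m : ℕ) :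
    Subgroup G where
  carrier := {d | d ∈ D ∧ ∃ k : ℕ, 0 < k ∧ k.Coprime m.factorial ∧ d ^ k = 1}
  one_mem' := ⟨D.one_mem, 1, one_pos, Nat.coprime_one_left _, one_pow 1⟩
  mul_mem' := by
    rintro a b ⟨ha, k, hk, hk', hak⟩ ⟨hb, l, hl, hl', hbl⟩
    refine ⟨D.mul_mem ha hb, k * l, Nat.mul_pos hk hl, Nat.Coprime.mul_left hk' hl', ?_⟩
    rw [Commute.mul_pow (show Commute a b from hc a ha b hb), pow_mul, hak, one_pow, mul_comm k,
      pow_mul, hbl, one_pow, one_mul]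
  inv_mem' := by
    rintro a ⟨ha, k, hk, hk', hak⟩
    exact ⟨D.inv_mem ha, k, hk, hk', by rw [inv_pow, hak, inv_one]⟩

theorem k18H_normal {G : Type*} [Group G] (D : Subgroup G) (hn : D.Normal)
    (hc : ∀ x ∈ D, ∀ y ∈ D, x * y = y * x) (m : ℕ) : (k18H D hc m).Normal := by
  refine ⟨?_⟩
  rintro d ⟨hd, k, hk, hk', hdk⟩ g
  exact ⟨hn.conj_mem d hd g, k, hk, hk', by rw [conj_pow, hdk]; simp⟩

theorem k18_comm_mul {G : Type*} [Group G] (D : Subgroup G) (hn : D.Normal)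
    (hc : ∀ x ∈ D, ∀ y ∈ D, x * y = y * x) (g a b : G) (ha : a ∈ D) (hb : b ∈ D) :
    ⁅g, a * b⁆ = ⁅g, a⁆ * ⁅g, b⁆ := by
  have h1 : ⁅g, b⁆ ∈ D := by
    rw [commutatorElement_def]; exact D.mul_mem (hn.conj_mem b hb g) (D.inv_mem hb)
  have h2 : ⁅g, a * b⁆ = ⁅g, a⁆ * (a * ⁅g, b⁆ * a⁻¹) := by
    simp only [commutatorElement_def]; group
  rw [h2, hc a ha _ h1, mul_inv_cancel_right]

theorem k18_comm_mem {G : Type*} [Group G] (D : Subgroup G) (hn : D.Normal)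
    (g b : G) (hb : b ∈ D) : ⁅g, b⁆ ∈ D := by
  rw [commutatorElement_def]; exact D.mul_mem (hn.conj_mem b hb g) (D.inv_mem hb)

theorem k18_comm_pow {G : Type*} [Group G] (D : Subgroup G) (hn : D.Normal)
    (hc : ∀ x ∈ D, ∀ y ∈ D, x * y = y * x) (g a : G) (ha : a ∈ D) (n : ℕ) :
    ⁅g, a ^ n⁆ = ⁅g, a⁆ ^ n := by
  induction n with
  | zero => simp
  | succ n ih => rw [pow_succ, k18_comm_mul D hn hc g _ _ (D.pow_mem ha n) ha, ih, pow_succ]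

def k18U {G : Type*} [Group G] (D : Subgroup G) (hn : D.Normal)
    (hc : ∀ x ∈ D, ∀ y ∈ D, x * y = y * x) (n : ℕ) : Subgroup G where
  carrier := {d | d ∈ D ∧ ∀ g : G, ⁅g, d⁆ ^ n = 1}
  one_mem' := ⟨D.one_mem, by simp⟩
  mul_mem' := by
    rintro a b ⟨ha, ha'⟩ ⟨hb, hb'⟩
    refine ⟨D.mul_mem ha hb, fun g => ?_⟩
    rw [k18_comm_mul D hn hc g a b ha hb, Commute.mul_pow
      (show Commute _ _ from hc _ (k18_comm_mem D hn g a ha) _ (k18_comm_mem D hn g b hb)),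
      ha', hb', one_mul]
  inv_mem' := by
    rintro a ⟨ha, ha'⟩
    refine ⟨D.inv_mem ha, fun g => ?_⟩
    have h1 := k18_comm_mul D hn hc g a a⁻¹ ha (D.inv_mem ha)
    rw [mul_inv_cancel, commutatorElement_one_right] at h1
    rw [eq_inv_of_mul_eq_one_right h1.symm, inv_pow, ha', inv_one]

theorem k18_rank {G : Type*} [Group G] (D : Subgroup G)
    (hper : ∀ a ∈ D, IsOfFinOrder a) (hc : ∀ x ∈ D, ∀ y ∈ D, x * y = y * x)
    (hrank : ∀ n : ℕ, ∃ F : Subgroup G, F ≤ D ∧ F.FG ∧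
      ¬∃ S : Finset G, S.card ≤ n ∧ Subgroup.closure (S : Set G) = F)
    (N : ℕ) (hN : ∀ d ∈ D, (orderOf d).Prime → orderOf d ∣ N) : Infinite (k18T D hc N) := by
  classical
  by_contra hfin
  rw [not_infinite_iff_finite] at hfin
  obtain ⟨F, hFD, hFG, hF⟩ := hrank (Nat.card (k18T D hc N))
  apply hF
  let _ : CommGroup F := { (inferInstance : Group F) with
    mul_comm := fun x y => Subtype.ext (hc x (hFD x.2) y (hFD y.2)) }
  have : Group.FG F := (Group.fg_iff_subgroup_fg F).2 hFG
  have hfinF : Finite F := CommGroup.finite_of_fg_torsion F (by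
    intro x
    exact Submonoid.isOfFinOrder_coe.1 (hper x (hFD x.2)))
  obtain ⟨ι, _, n, hn, ⟨e⟩⟩ := CommGroup.equiv_prod_multiplicative_zmod_of_finite F
  have hn0 : ∀ i, NeZero (n i) := fun i => ⟨by have := hn i; omega⟩
  let z : ∀ i, Multiplicative (ZMod (n i)) := fun i =>
    Multiplicative.ofAdd ((n i / (n i).minFac : ℕ) : ZMod (n i))
  have hz1 : ∀ i, z i ≠ 1 := by
    intro i h
    have h : ((n i / (n i).minFac : ℕ) : ZMod (n i)) = 0 := h
    rw [ZMod.natCast_eq_zero_iff] at h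
    have hp := Nat.minFac_prime (hn i).ne'
    have hpos : 0 < n i / (n i).minFac := Nat.div_pos (Nat.minFac_le (by have := hn i; omega)) hp.pos
    have := Nat.le_of_dvd hpos h
    have := Nat.div_lt_self (by have := hn i; omega : 0 < n i) hp.one_lt
    omega
  have hzp : ∀ i, z i ^ (n i).minFac = 1 := by
    intro i
    change Multiplicative.ofAdd ((n i).minFac • ((n i / (n i).minFac : ℕ) : ZMod (n i))) = 1
    rw [nsmul_eq_mul, ← Nat.cast_mul, Nat.mul_div_cancel' (Nat.minFac_dvd _), ZMod.natCast_self]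
    rfl
  let w : ι → F := fun i => e.symm (Pi.mulSingle i (z i))
  have hw1 : ∀ i, w i ≠ 1 := by
    intro i h
    rw [EmbeddingLike.map_eq_one_iff, Pi.mulSingle_eq_one_iff] at h
    exact hz1 i h
  have hwp : ∀ i, w i ^ (n i).minFac = 1 := by
    intro i
    change (e.symm _) ^ _ = 1
    rw [← map_pow, ← Pi.mulSingle_pow, hzp, Pi.mulSingle_one, map_one]
  have hwT : ∀ i, ((w i : F) : G) ∈ k18T D hc N := by
    intro i
    refine ⟨hFD (w i).2, ?_⟩
    have hp := Nat.minFac_prime (hn i).ne'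
    have : Fact (n i).minFac.Prime := ⟨hp⟩
    have ho : orderOf ((w i : F) : G) = (n i).minFac := by
      rw [Subgroup.orderOf_coe]
      exact orderOf_eq_prime (hwp i) (hw1 i)
    rw [← orderOf_dvd_iff_pow_eq_one]
    exact hN _ (hFD (w i).2) (ho ▸ hp)
  have hwinj : Function.Injective (fun i => (⟨w i, hwT i⟩ : k18T D hc N)) := by
    intro i j h
    have h : w i = w j := Subtype.ext (congrArg (fun x : k18T D hc N => (x : G)) h)
    have h := e.symm.injective h
    by_contra hij
    have h2 := congrFun h i
    rw [Pi.mulSingle_eq_same, Pi.mulSingle_eq_of_ne hij] at h2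
    exact hz1 i h2
  have hcard : Fintype.card ι ≤ Nat.card (k18T D hc N) := by
    rw [← Nat.card_eq_fintype_card]
    exact Nat.card_le_card_of_injective _ hwinj
  let v : ι → G := fun i => (e.symm (Pi.mulSingle i (Multiplicative.ofAdd 1)) : F)
  refine ⟨Finset.univ.image v, Finset.card_image_le.trans (by simpa using hcard), le_antisymm ?_ ?_⟩
  · rw [Subgroup.closure_le]
    intro x hx
    simp only [Finset.coe_image, Finset.coe_univ, Set.image_univ, Set.mem_range] at hx
    obtain ⟨i, rfl⟩ := hx
    exact (e.symm (Pi.mulSingle i (Multiplicative.ofAdd 1)) : F).2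
  · intro x hx
    let C : Subgroup F := (Subgroup.closure ((Finset.univ.image v : Finset G) : Set G)).comap F.subtype
    change (⟨x, hx⟩ : F) ∈ C
    rw [← e.symm_apply_apply ⟨x, hx⟩, ← Finset.univ_prod_mulSingle (e ⟨x, hx⟩), map_prod]
    refine C.prod_mem fun i _ => ?_
    generalize e ⟨x, hx⟩ i = y
    have hy : y = (Multiplicative.ofAdd (1 : ZMod (n i))) ^ (ZMod.val (Multiplicative.toAdd y)) := by
      rw [← ofAdd_nsmul, nsmul_one, ZMod.natCast_zmod_val]
      rfl
    rw [hy, Pi.mulSingle_pow, map_pow]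
    refine C.pow_mem ?_ _
    exact Subgroup.subset_closure (by simp [v])

theorem k18_pigeon {α : Type*} {S : Set α} (hS : S.Finite) (f : ℕ → α) (hf : ∀ n, f n ∈ S) :
    ∃ m0, ∀ m, ∃ k, m ≤ k ∧ f k = f m0 := by
  have : Finite S := hS
  obtain ⟨y, hy⟩ := Finite.exists_infinite_fiber (fun n => (⟨f n, hf n⟩ : S))
  have hinf := Set.infinite_coe_iff.1 hy
  obtain ⟨m0, hm0⟩ := hinf.nonempty
  refine ⟨m0, fun m => ?_⟩
  obtain ⟨k, hk, hmk⟩ := hinf.exists_gt m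
  exact ⟨k, hmk.le, congrArg Subtype.val (hk.trans hm0.symm)⟩

theorem k18_central {G : Type*} [Group G] (hG : PropKInf G)
    (D : Subgroup G) (hn : D.Normal)
    (hper : ∀ a ∈ D, IsOfFinOrder a)
    (hc : ∀ x ∈ D, ∀ y ∈ D, x * y = y * x)
    (hdiv : ∀ a ∈ D, ∀ n : ℕ, 0 < n → ∃ b ∈ D, b ^ n = a)
    (hrank : ∀ n : ℕ, ∃ F : Subgroup G, F ≤ D ∧ F.FG ∧
      ¬∃ S : Finset G, S.card ≤ n ∧ Subgroup.closure (S : Set G) = F) :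
    Infinite D ∧ D ≤ Subgroup.center G := by
  have hinf_le : ∀ {H K : Subgroup G}, Infinite H → H ≤ K → Infinite K := fun hH hle =>
    Infinite.of_injective _ (Subgroup.inclusion_injective hle)
  have hU : ∃ N, 0 < N ∧ Infinite (k18U D hn hc N) := by
    by_cases hN : ∃ N, 0 < N ∧ ∀ d ∈ D, (orderOf d).Prime → orderOf d ∣ N
    · obtain ⟨N, hN0, hN⟩ := hN
      refine ⟨N, hN0, hinf_le (k18_rank D hper hc hrank N hN) ?_⟩
      rintro d ⟨hd, hdN⟩
      refine ⟨hd, fun g => ?_⟩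
      rw [← k18_comm_pow D hn hc g d hd, hdN, commutatorElement_one_right]
    · have hH : ∀ m, Infinite (k18H D hc m) := by
        intro m
        by_contra hfin
        rw [not_infinite_iff_finite] at hfin
        apply hN
        refine ⟨m.factorial * Nat.card (k18H D hc m), Nat.mul_pos m.factorial_pos Nat.card_pos, ?_⟩
        intro d hd hp
        by_cases hle : orderOf d ≤ m
        · exact Dvd.dvd.mul_right (Nat.dvd_factorial hp.pos hle) _
        · refine Dvd.dvd.mul_left ?_ _
          have hmem : d ∈ k18H D hc m := ⟨hd, orderOf d, hp.pos,
            (Nat.coprime_factorial_iff hp.ne_one).2 (by rw [hp.minFac_eq]; omega), pow_orderOf_eq_one d⟩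
          have := orderOf_dvd_natCard (⟨d, hmem⟩ : k18H D hc m)
          rwa [← Subgroup.orderOf_coe] at this
      obtain ⟨m0, hm0⟩ := k18_pigeon (hG ⊤) (fun m => ⁅(⊤ : Subgroup G), k18H D hc m⁆)
        (fun m => ⟨_, hH m, rfl⟩)
      refine ⟨1, one_pos, hinf_le (hH m0) ?_⟩
      intro d hd
      refine ⟨hd.1, fun g => ?_⟩
      have hmem : ⁅g, d⁆ ∈ ⁅(⊤ : Subgroup G), k18H D hc m0⁆ :=
        Subgroup.commutator_mem_commutator (Subgroup.mem_top g) hd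
      rw [pow_one]
      generalize ⁅g, d⁆ = c at hmem
      obtain ⟨k, hk, hkeq⟩ := hm0 (orderOf c)
      rw [← hkeq] at hmem
      have := k18H_normal D hn hc k
      obtain ⟨hcD, l, hl, hl', hcl⟩ := Subgroup.commutator_le_right _ _ hmem
      rw [← orderOf_eq_one_iff]
      have h1 : orderOf c ∣ l := orderOf_dvd_of_pow_eq_one hcl
      have h2 : orderOf c ∣ k.factorial := Nat.dvd_factorial (hper c hcD).orderOf_pos hk
      exact Nat.eq_one_of_dvd_coprimes hl' h1 h2
  obtain ⟨N, hN0, hNinf⟩ := hU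
  have hUD : k18U D hn hc N ≤ D := fun d hd => hd.1
  refine ⟨hinf_le hNinf hUD, ?_⟩
  have hUinf : ∀ m : ℕ, Infinite (k18U D hn hc (N * m.factorial)) := by
    intro m
    refine hinf_le hNinf ?_
    intro d hd
    exact ⟨hd.1, fun g => by rw [pow_mul, hd.2 g, one_pow]⟩
  obtain ⟨m0, hm0⟩ := k18_pigeon (hG ⊤) (fun m => ⁅(⊤ : Subgroup G), k18U D hn hc (N * m.factorial)⁆)
        (fun m => ⟨_, hUinf m, rfl⟩)
  have hle : ⁅(⊤ : Subgroup G), k18U D hn hc (N * m0.factorial)⁆ ≤ k18T D hc (N * m0.factorial) := by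
    rw [Subgroup.commutator_le]
    intro g _ d hd
    exact ⟨k18_comm_mem D hn g d hd.1, hd.2 g⟩
  have hall : ∀ d ∈ D, ∀ g : G, ⁅g, d⁆ ^ (N * m0.factorial) = 1 := by
    intro d hd g
    obtain ⟨k, hk, hkeq⟩ := hm0 (orderOf d)
    have hdU : d ∈ k18U D hn hc (N * k.factorial) := by
      refine ⟨hd, fun g => ?_⟩
      have : d ^ (N * k.factorial) = 1 := orderOf_dvd_iff_pow_eq_one.1
        (Dvd.dvd.mul_left (Nat.dvd_factorial (hper d hd).orderOf_pos hk) _)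
      rw [← k18_comm_pow D hn hc g d hd, this, commutatorElement_one_right]
    have h1 : ⁅g, d⁆ ∈ ⁅(⊤ : Subgroup G), k18U D hn hc (N * k.factorial)⁆ :=
      Subgroup.commutator_mem_commutator (Subgroup.mem_top g) hdU
    exact (hle (hkeq ▸ h1)).2
  intro d hd
  rw [Subgroup.mem_center_iff]
  intro g
  obtain ⟨b, hb, rfl⟩ := hdiv d hd (N * m0.factorial) (Nat.mul_pos hN0 m0.factorial_pos)
  rw [← commutatorElement_eq_one_iff_mul_comm, k18_comm_pow D hn hc g b hb, hall b hb g]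

theorem stmt_18 (G : Type*) [Group G] (hsol : IsSolvable G) (hG : PropKInf G)
    (D : Subgroup G) (hnorm : D.Normal)
    (hper : ∀ a ∈ D, IsOfFinOrder a)
    (hab : ∀ x y : D, x * y = y * x)
    (hdiv : ∀ a ∈ D, ∀ n : ℕ, 0 < n → ∃ b ∈ D, b ^ n = a)
    (hrank : ∀ n : ℕ, ∃ F : Subgroup G, F ≤ D ∧ F.FG ∧
      ¬∃ S : Finset G, S.card ≤ n ∧ Subgroup.closure (S : Set G) = F) :
    Finite (commutator G) := by
  have hc : ∀ x ∈ D, ∀ y ∈ D, x * y = y * x := fun x hx y hy =>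
    congrArg Subtype.val (hab ⟨x, hx⟩ ⟨y, hy⟩)
  obtain ⟨hinf, hcen⟩ := k18_central hG D hnorm hper hc hdiv hrank
  have hK : K18 G := by
    intro X
    refine (hG X).subset ?_
    rintro _ ⟨H, rfl⟩
    refine ⟨H ⊔ D, Infinite.of_injective _
      (Subgroup.inclusion_injective (le_sup_right : D ≤ H ⊔ D)),
      le_antisymm (Subgroup.commutator_mono le_rfl le_sup_left) ?_⟩
    rw [Subgroup.commutator_le]
    intro x hx y hy
    obtain ⟨h, hh, d, hd, rfl⟩ := Subgroup.mem_sup_of_normal_right.1 hy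
    have hd' := Subgroup.mem_center_iff.1 (hcen hd)
    have : ⁅x, h * d⁆ = ⁅x, h⁆ := by
      simp only [commutatorElement_def, mul_inv_rev]
      rw [← mul_assoc x, mul_assoc (x * h), ← hd' x⁻¹]
      group
    rw [this]
    exact Subgroup.commutator_mem_commutator hx hh
  obtain ⟨n, hn⟩ := hsol.solvable
  exact k18_solvable n G hK hn
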